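/- Main model lemma: let (mem, diff) be an MLS-conjunction over ι, assume that both M and N satisfy it, and assume rk(M i) < rk(s) for every i : ι. Let n̄ = card ι. Then the enlarged assignment M_{n̄} also satisfies the MLS-conjunction, i.e., M_{n̄} x ∈ M_{n̄} y for every (x,y) ∈ mem, and M_{n̄} x = M_{n̄} y \ M_{n̄} z for every (x,y,z) ∈ diff. -/

import Mathlib

/-- An assignment `A` satisfies the MLS-conjunction given by the membership atoms
`mem` (atom `(x, y)` means `x ∈ y`) and the difference atoms `diff`
(atom `(x, y, z)` means `x = y \\ z`). -/
def MLSSat {ι : Type} (mem : Finset (ι × ι)) (diff : Finset (ι × ι × ι))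
    (A : ι → ZFSet) : Prop :=
  (∀ p ∈ mem, A p.1 ∈ A p.2) ∧ (∀ p ∈ diff, A p.1 = A p.2.1 \ A p.2.2)

-- The recursive enlargement construction from the convexity proof for MLS:
-- `mlsStage M N s t n = (Vₙ, Mₙ)`, where
-- `V₀ = {u | t ∈ N u}`, `Vₙ₊₁ = {u | ∃ v ∈ Vₙ, M v ∈ M u}`,
-- `M₀ u = M u ∪ {s}` if `u ∈ V₀` and `M u` otherwise, and
-- `Mₙ₊₁ u = Mₙ u ∪ {Mₙ v | v ∈ Vₙ ∧ M v ∈ M u}` if `u ∈ Vₙ₊₁` and `Mₙ u` otherwise.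
open Classical in
noncomputable def mlsStage {ι : Type} [Fintype ι] (M N : ι → ZFSet) (s t : ZFSet) :
    ℕ → Set ι × (ι → ZFSet)
  | 0 => ({u | t ∈ N u}, fun u => if t ∈ N u then M u ∪ {s} else M u)
  | n + 1 =>
      let P := mlsStage M N s t n
      ({u | ∃ v ∈ P.1, M v ∈ M u},
        fun u =>
          if ∃ v ∈ P.1, M v ∈ M u then
            P.2 u ∪ ZFSet.range (fun v : {v : ι // v ∈ P.1 ∧ M v ∈ M u} => P.2 v.1)
          else P.2 u)

/-- `Vₙ`, the set of variables modified at stage `n`. -/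
noncomputable def mlsV {ι : Type} [Fintype ι] (M N : ι → ZFSet) (s t : ZFSet) (n : ℕ) :
    Set ι :=
  (mlsStage M N s t n).1

/-- `Mₙ`, the enlarged assignment at stage `n`. -/
noncomputable def mlsM {ι : Type} [Fintype ι] (M N : ι → ZFSet) (s t : ZFSet) (n : ℕ) :
    ι → ZFSet :=
  (mlsStage M N s t n).2

section MLSStage

variable {ι : Type} [Fintype ι] {M N : ι → ZFSet} {s t : ZFSet}

theorem mem_mlsV_zero {u : ι} : u ∈ mlsV M N s t 0 ↔ t ∈ N u := Iff.rfl

theorem mem_mlsM_zero {u : ι} {e : ZFSet} :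
    e ∈ mlsM M N s t 0 u ↔ e ∈ M u ∨ (e = s ∧ t ∈ N u) := by
  simp only [mlsM, mlsStage]
  split_ifs with h <;> simp [h]

theorem mem_mlsM_succ {n : ℕ} {u : ι} {e : ZFSet} :
    e ∈ mlsM M N s t (n + 1) u ↔
      e ∈ mlsM M N s t n u ∨ ∃ v ∈ mlsV M N s t n, M v ∈ M u ∧ e = mlsM M N s t n v := by
  simp only [mlsM, mlsV, mlsStage]
  split_ifs with h
  · simp [ZFSet.mem_range, eq_comm, and_assoc]
  · refine (or_iff_left ?_).symm
    rintro ⟨v, hv, hvu, -⟩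
    exact h ⟨v, hv, hvu⟩

theorem mem_mlsM {n : ℕ} {u : ι} {e : ZFSet} :
    e ∈ mlsM M N s t n u ↔ e ∈ M u ∨ (e = s ∧ t ∈ N u) ∨
      ∃ k < n, ∃ v ∈ mlsV M N s t k, M v ∈ M u ∧ e = mlsM M N s t k v := by
  induction n with
  | zero => simp [mem_mlsM_zero]
  | succ n ih => simp only [mem_mlsM_succ, ih, Nat.exists_lt_succ_right, or_assoc]

theorem mlsM_zero_of_notMem {u : ι} (h : u ∉ mlsV M N s t 0) : mlsM M N s t 0 u = M u := by
  ext e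
  rw [mem_mlsV_zero] at h
  simp [mem_mlsM_zero, h]

theorem mlsM_succ_of_notMem {n : ℕ} {u : ι} (h : u ∉ mlsV M N s t (n + 1)) :
    mlsM M N s t (n + 1) u = mlsM M N s t n u := by
  ext e
  rw [mem_mlsM_succ]
  refine or_iff_left ?_
  rintro ⟨v, hv, hvu, -⟩
  exact h ⟨v, hv, hvu⟩

theorem rank_lt_rank_mlsM {n : ℕ} {u : ι} (h : u ∈ mlsV M N s t n) :
    s.rank < (mlsM M N s t n u).rank := by
  induction n generalizing u with
  | zero => exact ZFSet.rank_lt_of_mem (mem_mlsM_zero.2 (.inr ⟨rfl, h⟩))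
  | succ n ih =>
    obtain ⟨v, hv, hvu⟩ := h
    exact (ih hv).trans (ZFSet.rank_lt_of_mem (mem_mlsM_succ.2 (.inr ⟨v, hv, hvu, rfl⟩)))

/-- Below the rank of `s`, the enlarged assignments agree with `M`. -/
theorem mem_mlsM_of_rank_lt {n : ℕ} {u : ι} {e : ZFSet} (he : e.rank < s.rank) :
    e ∈ mlsM M N s t n u ↔ e ∈ M u := by
  rw [mem_mlsM]
  refine or_iff_left ?_
  rintro (⟨rfl, -⟩ | ⟨k, -, v, hv, -, rfl⟩)
  · exact he.false
  · exact he.not_gt (rank_lt_rank_mlsM hv)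

/-- The enlarged value of a variable determines its original value. -/
theorem eq_of_mlsM_eq (hrk : ∀ i, (M i).rank < s.rank) {k j : ℕ} {v w : ι}
    (h : mlsM M N s t k v = mlsM M N s t j w) : M v = M w := by
  ext e
  by_cases he : e.rank < s.rank
  · rw [← mem_mlsM_of_rank_lt (n := k) he, h, mem_mlsM_of_rank_lt he]
  · exact iff_of_false (fun h => he ((ZFSet.rank_lt_of_mem h).trans (hrk v)))
      (fun h => he ((ZFSet.rank_lt_of_mem h).trans (hrk w)))

theorem mem_mlsM_self_iff (hrk : ∀ i, (M i).rank < s.rank) {n : ℕ} {u : ι} :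
    s ∈ mlsM M N s t n u ↔ t ∈ N u := by
  rw [mem_mlsM]
  constructor
  · rintro (h | ⟨-, h⟩ | ⟨k, -, v, hv, -, h⟩)
    · exact absurd (ZFSet.rank_lt_of_mem h) (hrk u).not_gt
    · exact h
    · exact absurd (congrArg ZFSet.rank h) (rank_lt_rank_mlsM hv).ne
  · exact fun h => .inr (.inl ⟨rfl, h⟩)

theorem mlsM_mem_mlsM_iff (hrk : ∀ i, (M i).rank < s.rank) {k n : ℕ} (hk : k < n) {v u : ι}
    (hv : v ∈ mlsV M N s t k) : mlsM M N s t k v ∈ mlsM M N s t n u ↔ M v ∈ M u := by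
  have hs := rank_lt_rank_mlsM hv
  rw [mem_mlsM]
  constructor
  · rintro (h | ⟨h, -⟩ | ⟨j, -, w, -, hw, h⟩)
    · exact absurd ((ZFSet.rank_lt_of_mem h).trans (hrk u)) hs.not_gt
    · exact absurd (congrArg ZFSet.rank h) hs.ne'
    · rwa [eq_of_mlsM_eq hrk h]
  · exact fun h => .inr (.inr ⟨k, hk, v, hv, h, rfl⟩)

theorem mlsM_eq_sdiff (hrk : ∀ i, (M i).rank < s.rank) {x y z : ι}
    (hM : M x = M y \ M z) (hN : N x = N y \ N z) (n : ℕ) :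
    mlsM M N s t n x = mlsM M N s t n y \ mlsM M N s t n z := by
  suffices H : ∀ u e, e ∈ mlsM M N s t n u →
      (e ∈ mlsM M N s t n x ↔ e ∈ mlsM M N s t n y ∧ e ∉ mlsM M N s t n z) by
    ext e
    rw [ZFSet.mem_sdiff]
    exact ⟨fun h => (H x e h).1 h, fun h => (H y e h.1).2 h⟩
  intro u e he
  obtain he | ⟨rfl, -⟩ | ⟨k, hk, v, hv, -, rfl⟩ := mem_mlsM.1 he
  · simp only [mem_mlsM_of_rank_lt ((ZFSet.rank_lt_of_mem he).trans (hrk u)), hM,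
      ZFSet.mem_sdiff]
  · simp only [mem_mlsM_self_iff hrk, hN, ZFSet.mem_sdiff]
  · simp only [mlsM_mem_mlsM_iff hrk hk hv, hM, ZFSet.mem_sdiff]

open Classical in
theorem lt_card_of_mem_mlsV {n : ℕ} {u : ι} (h : u ∈ mlsV M N s t n) :
    n < (Finset.univ.filter fun w => (M w).rank ≤ (M u).rank).card := by
  induction n generalizing u with
  | zero => exact Finset.card_pos.2 ⟨u, by simp⟩
  | succ n ih =>
    obtain ⟨v, hv, hvu⟩ := h
    have hlt := ZFSet.rank_lt_of_mem hvu
    refine (Nat.succ_le_of_lt (ih hv)).trans_lt (Finset.card_lt_card ?_)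
    refine Finset.ssubset_iff_of_subset (fun w => ?_) |>.2 ⟨u, by simp, by simpa using hlt⟩
    simpa using fun hw => hw.trans hlt.le

theorem notMem_mlsV_card (u : ι) : u ∉ mlsV M N s t (Fintype.card ι) := fun h =>
  (lt_card_of_mem_mlsV h).not_ge (Finset.card_le_univ _)

theorem mlsM_mem_mlsM_succ {x y : ι} (h : M x ∈ M y) (n : ℕ) :
    mlsM M N s t n x ∈ mlsM M N s t (n + 1) y := by
  by_cases hx : x ∈ mlsV M N s t n
  · exact mem_mlsM_succ.2 (.inr ⟨x, hx, h, rfl⟩)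
  · induction n with
    | zero =>
      rw [mlsM_zero_of_notMem hx]
      exact mem_mlsM.2 (.inl h)
    | succ n ih =>
      rw [mlsM_succ_of_notMem hx]
      by_cases hn : x ∈ mlsV M N s t n
      · exact mem_mlsM_succ.2 (.inl (mem_mlsM_succ.2 (.inr ⟨x, hn, h, rfl⟩)))
      · exact mem_mlsM_succ.2 (.inl (ih hn))

theorem mlsM_card_mem {x y : ι} (h : M x ∈ M y) :
    mlsM M N s t (Fintype.card ι) x ∈ mlsM M N s t (Fintype.card ι) y := by
  have hx : x ∉ mlsV M N s t (Fintype.card ι) := notMem_mlsV_card x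
  obtain ⟨m, hm⟩ := Nat.exists_eq_succ_of_ne_zero (Fintype.card_pos_iff.2 ⟨x⟩).ne'
  rw [hm] at hx ⊢
  rw [mlsM_succ_of_notMem hx]
  exact mlsM_mem_mlsM_succ h m

end MLSStage

/-- Main model lemma: if both `M` and `N` satisfy the MLS-conjunction and
`rank (M i) < rank s` for every `i`, then the enlarged assignment `M_{card ι}`
also satisfies the MLS-conjunction. -/
theorem mlsM_card_satisfies {ι : Type} [Fintype ι]
    (mem : Finset (ι × ι)) (diff : Finset (ι × ι × ι))
    (M N : ι → ZFSet) (s t : ZFSet)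
    (hM : MLSSat mem diff M) (hN : MLSSat mem diff N)
    (hrk : ∀ i : ι, (M i).rank < s.rank) :
    MLSSat mem diff (mlsM M N s t (Fintype.card ι)) :=
  ⟨fun p hp => mlsM_card_mem (hM.1 p hp),
    fun p hp => mlsM_eq_sdiff hrk (hM.2 p hp) (hN.2 p hp) _⟩
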